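/- Let λ1 > 0, λ2 > 0 and μ1 = λ1/(λ1+λ2). Then for every x ≥ 0, ∫_0^∞ θ_{μ1}(e^{−(λ1+λ2)u}) e^{−ux} du = (1/(λ1+λ2)) · π sin(π μ1) / ( cos(π √(μ1² − 4x/(λ1+λ2))) − cos(π μ1) ). -/

import Mathlib

open MeasureTheory

/-- The theta-type function `θ_μ(q) = Σ_{n∈ℤ} (n + μ/2) q^{n(n+μ)}` (real powers). -/
noncomputable def thetaMu (mu q : ℝ) : ℝ :=
  ∑' n : ℤ, ((n : ℝ) + mu / 2) * q ^ ((n : ℝ) * ((n : ℝ) + mu))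

/-- The entire function `z ↦ Σ_{n≥0} (−π² z)^n/(2n)!`, which equals `cos(π√z)` for `z ≥ 0`
and `cosh(π√(−z))` for `z ≤ 0`. -/
noncomputable def cosPiSqrt (z : ℝ) : ℝ :=
  ∑' n : ℕ, (-(Real.pi ^ 2) * z) ^ n / ((2 * n).factorial : ℝ)

open Filter

/-- The sum of a series of functions that converges absolutely in `L¹` is integrable, and may be
integrated term by term. -/
lemma integrable_and_hasSum_integral_of_hasSum {α : Type*} [MeasurableSpace α] {ν : Measure α}
    {F : ℕ → α → ℝ} {f : α → ℝ} (hF : ∀ n, Integrable (F n) ν)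
    (hsum : Summable fun n ↦ ∫ a, ‖F n a‖ ∂ν) (hf : ∀ᵐ a ∂ν, HasSum (F · a) (f a)) :
    Integrable f ν ∧ HasSum (fun n ↦ ∫ a, F n a ∂ν) (∫ a, f a ∂ν) := by
  have hfin : ∑' n, ∫⁻ a, ‖F n a‖ₑ ∂ν ≠ ⊤ := by
    have key (n : ℕ) : ∫⁻ a, ‖F n a‖ₑ ∂ν = ENNReal.ofReal (∫ a, ‖F n a‖ ∂ν) :=
      (ofReal_integral_norm_eq_lintegral_enorm (hF n)).symm
    simp_rw [key]
    exact hsum.tsum_ofReal_ne_top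
  constructor
  · refine ⟨?_, ?_⟩
    · refine aestronglyMeasurable_of_tendsto_ae atTop
        (f := fun N a ↦ ∑ n ∈ Finset.range N, F n a)
        (fun N ↦ (integrable_finsetSum _ fun n _ ↦ hF n).1) ?_
      filter_upwards [hf] with a ha using ha.tendsto_sum_nat
    · calc ∫⁻ a, ‖f a‖ₑ ∂ν ≤ ∫⁻ a, ∑' n, ‖F n a‖ₑ ∂ν := by
            refine lintegral_mono_ae ?_
            filter_upwards [hf] with a ha
            rw [← ha.tsum_eq]
            exact enorm_tsum_le_tsum_enorm
        _ = ∑' n, ∫⁻ a, ‖F n a‖ₑ ∂ν := lintegral_tsum fun n ↦ (hF n).1.enorm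
        _ < ⊤ := hfin.lt_top
  · have h := hasSum_integral_of_summable_integral_norm hF hsum
    rwa [integral_congr_ae (g := f) (hf.mono fun a ha ↦ ha.tsum_eq)] at h

lemma summable_thetaMu {mu q : ℝ} (hmu0 : 0 < mu) (hmu1 : mu < 1) (hq0 : 0 < q) (hq1 : q < 1) :
    Summable fun n : ℤ ↦ ((n : ℝ) + mu / 2) * q ^ ((n : ℝ) * ((n : ℝ) + mu)) := by
  have hr0 : 0 < q ^ (1 - mu) := Real.rpow_pos_of_pos hq0 _
  have hr1 : q ^ (1 - mu) < 1 := Real.rpow_lt_one hq0.le hq1 (by linarith)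
  have hmain : Summable fun n : ℕ ↦ ((n : ℝ) + 1) * (q ^ (1 - mu)) ^ n := by
    have h1 := summable_pow_mul_geometric_of_norm_lt_one (R := ℝ) 1 (r := q ^ (1 - mu))
      (by rwa [Real.norm_of_nonneg hr0.le])
    have h0 := summable_geometric_of_lt_one hr0.le hr1
    refine (h1.add h0).congr fun n ↦ ?_
    ring
  have hpow (n : ℕ) (e : ℝ) (he : (1 - mu) * n ≤ e) : q ^ e ≤ (q ^ (1 - mu)) ^ n := by
    rw [← Real.rpow_natCast, ← Real.rpow_mul hq0.le]
    exact Real.rpow_le_rpow_of_exponent_ge hq0 hq1.le he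
  have hsq (n : ℕ) : (n : ℝ) ≤ (n : ℝ) * n := by exact_mod_cast Nat.le_mul_self n
  refine Summable.of_nat_of_neg (hmain.of_norm_bounded fun n ↦ ?_)
    (hmain.of_norm_bounded fun n ↦ ?_)
  · have hn : (0 : ℝ) ≤ n := n.cast_nonneg
    rw [norm_mul, Real.norm_of_nonneg (Real.rpow_nonneg hq0.le _), Real.norm_eq_abs]
    push_cast
    refine mul_le_mul (abs_le.2 ⟨by linarith, by linarith⟩) (hpow n _ ?_)
      (Real.rpow_nonneg hq0.le _) (by linarith)
    nlinarith [hsq n, mul_nonneg hn hmu0.le]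
  · have hn : (0 : ℝ) ≤ n := n.cast_nonneg
    rw [norm_mul, Real.norm_of_nonneg (Real.rpow_nonneg hq0.le _), Real.norm_eq_abs]
    push_cast
    refine mul_le_mul (abs_le.2 ⟨by linarith, by linarith⟩) (hpow n _ ?_)
      (Real.rpow_nonneg hq0.le _) (by linarith)
    nlinarith [hsq n, mul_nonneg hn hmu0.le]

/-- The terms of index `n + 1` and `-(n + 1)` of `θ_μ(e^{-Lu}) e^{-ux}`, taken together. -/
noncomputable def thetaPair (L mu x : ℝ) (n : ℕ) (u : ℝ) : ℝ :=
  ((n + 1 : ℝ) + mu / 2) * Real.exp (-(L * ((n + 1) * (n + 1 + mu)) + x) * u)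
    - ((n + 1 : ℝ) - mu / 2) * Real.exp (-(L * ((n + 1) * (n + 1 - mu)) + x) * u)

lemma hasSum_thetaPair {L mu u : ℝ} (hL : 0 < L) (hmu0 : 0 < mu) (hmu1 : mu < 1) (hu : 0 < u)
    (x : ℝ) :
    HasSum (fun n ↦ thetaPair L mu x n u)
      (thetaMu mu (Real.exp (-L * u)) * Real.exp (-u * x) - mu / 2 * Real.exp (-x * u)) := by
  have hq1 : Real.exp (-L * u) < 1 := Real.exp_lt_one_iff.2 (by nlinarith [mul_pos hL hu])
  have h := (summable_thetaMu hmu0 hmu1 (Real.exp_pos _) hq1).hasSum.nat_add_neg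
  have h' := ((hasSum_nat_add_iff' 1).2 h).mul_right (Real.exp (-u * x))
  refine Eq.mpr (congrArg₂ (fun (f : ℕ → ℝ) a ↦ HasSum f a) (funext fun n ↦ ?_) ?_) h'
  · simp only [thetaPair, ← Real.exp_mul]
    push_cast
    have hB : Real.exp (-(L * ((n + 1) * (n + 1 + mu)) + x) * u) =
        Real.exp (-L * u * ((n + 1) * (n + 1 + mu))) * Real.exp (-u * x) := by
      rw [← Real.exp_add]
      ring_nf
    have hA : Real.exp (-(L * ((n + 1) * (n + 1 - mu)) + x) * u) =
        Real.exp (-L * u * (-(n + 1) * (-(n + 1) + mu))) * Real.exp (-u * x) := by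
      rw [← Real.exp_add]
      ring_nf
    rw [hA, hB]
    ring
  · have hx : Real.exp (-x * u) = Real.exp (-u * x) := by ring_nf
    rw [← thetaMu, hx]
    simp
    ring

lemma integral_exp_neg_mul_Ioi_zero {A : ℝ} (hA : 0 < A) :
    ∫ u in Set.Ioi (0 : ℝ), Real.exp (-A * u) = 1 / A := by
  rw [integral_exp_mul_Ioi (by linarith)]
  simp [neg_div_neg_eq]

lemma le_exponent_add {L mu x : ℝ} (hL : 0 < L) (hmu0 : 0 < mu) (hx : 0 ≤ x) (n : ℕ) :
    L * (n + 1 : ℝ) ^ 2 ≤ L * ((n + 1) * (n + 1 + mu)) + x := by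
  have hn : (0 : ℝ) ≤ n := n.cast_nonneg
  have : 0 ≤ L * ((n + 1) * mu) := by positivity
  nlinarith

lemma le_exponent_sub {L mu x : ℝ} (hL : 0 < L) (hmu0 : 0 < mu) (hx : 0 ≤ x) (n : ℕ) :
    L * ((1 - mu) * (n + 1 : ℝ) ^ 2) ≤ L * ((n + 1) * (n + 1 - mu)) + x := by
  have hn : (0 : ℝ) ≤ n := n.cast_nonneg
  have : 0 ≤ L * ((n + 1) * (n * mu)) := by positivity
  nlinarith

lemma exponent_add_pos {L mu x : ℝ} (hL : 0 < L) (hmu0 : 0 < mu) (hx : 0 ≤ x) (n : ℕ) :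
    0 < L * ((n + 1) * (n + 1 + mu)) + x :=
  lt_of_lt_of_le (by positivity) (le_exponent_add hL hmu0 hx n)

lemma exponent_sub_pos {L mu x : ℝ} (hL : 0 < L) (hmu0 : 0 < mu) (hmu1 : mu < 1)
    (hx : 0 ≤ x) (n : ℕ) :
    0 < L * ((n + 1) * (n + 1 - mu)) + x :=
  lt_of_lt_of_le (mul_pos hL (mul_pos (by linarith) (by positivity)))
    (le_exponent_sub hL hmu0 hx n)

lemma integrable_thetaPair {L mu x : ℝ} (hL : 0 < L) (hmu0 : 0 < mu) (hmu1 : mu < 1)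
    (hx : 0 ≤ x) (n : ℕ) :
    IntegrableOn (thetaPair L mu x n) (Set.Ioi 0) :=
  ((integrableOn_exp_mul_Ioi
      (by linarith [exponent_add_pos hL hmu0 hx n]) 0).const_mul _).sub
    ((integrableOn_exp_mul_Ioi
      (by linarith [exponent_sub_pos hL hmu0 hmu1 hx n]) 0).const_mul _)

lemma integral_thetaPair {L mu x : ℝ} (hL : 0 < L) (hmu0 : 0 < mu) (hmu1 : mu < 1)
    (hx : 0 ≤ x) (n : ℕ) :
    ∫ u in Set.Ioi (0 : ℝ), thetaPair L mu x n u =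
    ((n + 1 : ℝ) + mu / 2) / (L * ((n + 1) * (n + 1 + mu)) + x)
      - ((n + 1 : ℝ) - mu / 2) / (L * ((n + 1) * (n + 1 - mu)) + x) := by
  have hB := exponent_add_pos hL hmu0 hx n
  have hA := exponent_sub_pos hL hmu0 hmu1 hx n
  simp only [thetaPair]
  rw [integral_sub ((integrableOn_exp_mul_Ioi (by linarith) 0).const_mul _)
      ((integrableOn_exp_mul_Ioi (by linarith) 0).const_mul _), integral_const_mul,
    integral_const_mul, integral_exp_neg_mul_Ioi_zero hA, integral_exp_neg_mul_Ioi_zero hB]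
  ring

lemma integral_norm_thetaPair_le {L mu x : ℝ} (hL : 0 < L) (hmu0 : 0 < mu) (hmu1 : mu < 1)
    (hx : 0 ≤ x) (n : ℕ) :
    ∫ u in Set.Ioi (0 : ℝ), ‖thetaPair L mu x n u‖ ≤
    3 * mu / (L * (1 - mu)) * (1 / (n + 1 : ℝ) ^ 2) := by
  have hB := exponent_add_pos hL hmu0 hx n
  have hA := exponent_sub_pos hL hmu0 hmu1 hx n
  have hB' := le_exponent_add hL hmu0 hx n
  have hA' := le_exponent_sub hL hmu0 hx n
  set B := L * ((n + 1) * (n + 1 + mu)) + x with hBdef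
  set A := L * ((n + 1) * (n + 1 - mu)) + x with hAdef
  have hm : (0 : ℝ) < n + 1 := by positivity
  have hAB : B - A = 2 * L * mu * (n + 1) := by rw [hBdef, hAdef]; ring
  have hAB' : A ≤ B := by nlinarith [mul_pos (mul_pos hL hmu0) hm]
  have iA := integrableOn_exp_mul_Ioi (a := -A) (by linarith) 0
  have iB := integrableOn_exp_mul_Ioi (a := -B) (by linarith) 0
  have hbound (u : ℝ) (hu : u ∈ Set.Ioi (0 : ℝ)) : ‖thetaPair L mu x n u‖ ≤
      ((n + 1 : ℝ) + mu / 2) * Real.exp (-A * u) - ((n + 1 : ℝ) - mu / 2) * Real.exp (-B * u) := by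
    have hle : Real.exp (-B * u) ≤ Real.exp (-A * u) :=
      Real.exp_le_exp.2 (by nlinarith [Set.mem_Ioi.1 hu])
    have := Real.exp_pos (-B * u)
    rw [thetaPair, ← hBdef, ← hAdef, Real.norm_eq_abs, abs_le]
    constructor <;> nlinarith
  have h1m : 0 < 1 - mu := by linarith
  calc _ ≤ ∫ u in Set.Ioi (0 : ℝ), (((n + 1 : ℝ) + mu / 2) * Real.exp (-A * u)
          - ((n + 1 : ℝ) - mu / 2) * Real.exp (-B * u)) :=
        setIntegral_mono_on (integrable_thetaPair hL hmu0 hmu1 hx n).norm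
          ((iA.const_mul _).sub (iB.const_mul _)) measurableSet_Ioi hbound
    _ = (n + 1 : ℝ) * ((B - A) / (A * B)) + mu / 2 * (1 / A + 1 / B) := by
        rw [integral_sub (iA.const_mul _) (iB.const_mul _), integral_const_mul,
          integral_const_mul, integral_exp_neg_mul_Ioi_zero hA, integral_exp_neg_mul_Ioi_zero hB]
        field_simp
        ring
    _ ≤ (n + 1 : ℝ) * (2 * L * mu * (n + 1) /
            ((L * ((1 - mu) * (n + 1 : ℝ) ^ 2)) * (L * (n + 1 : ℝ) ^ 2)))
          + mu / 2 * (1 / (L * ((1 - mu) * (n + 1 : ℝ) ^ 2))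
            + 1 / (L * ((1 - mu) * (n + 1 : ℝ) ^ 2))) := by
        rw [hAB]
        have := hA'.trans hAB'
        gcongr
    _ = 3 * mu / (L * (1 - mu)) * (1 / (n + 1 : ℝ) ^ 2) := by
        field_simp
        ring

lemma summable_integral_norm_thetaPair {L mu x : ℝ} (hL : 0 < L) (hmu0 : 0 < mu) (hmu1 : mu < 1)
    (hx : 0 ≤ x) :
    Summable fun n ↦ ∫ u in Set.Ioi (0 : ℝ), ‖thetaPair L mu x n u‖ := by
  refine Summable.of_nonneg_of_le (fun n ↦ integral_nonneg fun u ↦ norm_nonneg _)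
    (integral_norm_thetaPair_le hL hmu0 hmu1 hx) (Summable.mul_left _ ?_)
  have := (summable_nat_add_iff 1).2 (Real.summable_one_div_nat_pow.2 one_lt_two)
  simpa using this

lemma cosPiSqrt_eq_cos {z : ℝ} {w : ℂ} (hw : w ^ 2 = z) :
    (cosPiSqrt z : ℂ) = Complex.cos (Real.pi * w) := by
  rw [Complex.cos_eq_tsum, cosPiSqrt, Complex.ofReal_tsum]
  refine tsum_congr fun n ↦ ?_
  push_cast
  rw [pow_mul, mul_pow (Real.pi : ℂ) w 2, hw, ← mul_pow]
  ring_nf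

lemma hasSum_cot {z : ℂ} (hz : z ∈ Complex.integerComplement) :
    HasSum (fun n : ℕ ↦ 1 / (z - (n + 1)) + 1 / (z + (n + 1)))
      (Real.pi * Complex.cot (Real.pi * z) - 1 / z) := by
  rw [cot_series_rep' hz]
  exact (summable_cotTerm hz).hasSum

lemma cot_sub_add_cot_add {a w : ℂ} (h1 : Complex.sin (a - w) ≠ 0)
    (h2 : Complex.sin (a + w) ≠ 0) :
    Complex.cot (a - w) + Complex.cot (a + w) =
      2 * Complex.sin (2 * a) / (Complex.cos (2 * w) - Complex.cos (2 * a)) := by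
  have hprod : Complex.cos (2 * w) - Complex.cos (2 * a) =
      2 * (Complex.sin (a - w) * Complex.sin (a + w)) := by
    rw [Complex.cos_sub_cos]
    rw [show (2 * w + 2 * a) / 2 = a + w by ring, show (2 * w - 2 * a) / 2 = -(a - w) by ring,
      Complex.sin_neg]
    ring
  have hsum : Complex.sin (2 * a) = Complex.cos (a - w) * Complex.sin (a + w)
      + Complex.cos (a + w) * Complex.sin (a - w) := by
    rw [show 2 * a = (a - w) + (a + w) by ring, Complex.sin_add]
    ring
  rw [hprod, hsum, Complex.cot, Complex.cot]
  field_simp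

/-- The series `Σ_{n∈ℤ} (n + μ/2)/(L n(n+μ) + x)`, summed symmetrically and without its term of
index `0`. -/
lemma hasSum_integral_thetaPair {L mu x : ℝ} (hL : 0 < L) (hmu0 : 0 < mu) (hmu1 : mu < 1)
    (hx : 0 < x) :
    HasSum (fun n ↦ ∫ u in Set.Ioi (0 : ℝ), thetaPair L mu x n u)
      ((1 / L) * (Real.pi * Real.sin (Real.pi * mu))
        / (cosPiSqrt (mu ^ 2 - 4 * x / L) - Real.cos (Real.pi * mu)) - mu / 2 / x) := by
  obtain ⟨w, hw⟩ := IsAlgClosed.exists_pow_nat_eq ((mu ^ 2 / 4 - x / L : ℝ) : ℂ) two_pos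
  have hLC : (L : ℂ) ≠ 0 := by exact_mod_cast hL.ne'
  have hfactor (k : ℤ) : (L : ℂ) * ((mu / 2 - w + k) * (mu / 2 + w + k)) =
      ((L * (k * (k + mu)) + x : ℝ) : ℂ) := by
    have : (mu / 2 - w + k) * (mu / 2 + w + k) = (k + mu / 2) ^ 2 - w ^ 2 := by ring
    rw [this, hw]
    push_cast
    field_simp
    ring
  have hpos (k : ℤ) : 0 < L * (k * (k + mu)) + x := by
    have : (0 : ℝ) ≤ k * (k + mu) := by
      rcases le_or_gt 0 k with hk | hk
      · have : (0 : ℝ) ≤ k := by exact_mod_cast hk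
        positivity
      · have : (k : ℝ) ≤ -1 := by exact_mod_cast Int.le_sub_one_of_lt hk
        nlinarith
    positivity
  have hne (k : ℤ) : (mu / 2 - w + k) * (mu / 2 + w + k) ≠ 0 := by
    intro h
    have := hfactor k
    rw [h, mul_zero] at this
    exact (hpos k).ne (by exact_mod_cast this)
  have hz1 : (mu / 2 - w : ℂ) ∈ Complex.integerComplement := by
    rintro ⟨k, hk⟩
    exact hne (-k) (by rw [← hk]; push_cast; ring)
  have hz2 : (mu / 2 + w : ℂ) ∈ Complex.integerComplement := by
    rintro ⟨k, hk⟩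
    exact hne (-k) (by rw [← hk]; push_cast; ring)
  have hcot := ((hasSum_cot hz1).add (hasSum_cot hz2)).mul_left (1 / (2 * L : ℂ))
  rw [← Complex.hasSum_ofReal]
  refine Eq.mpr (congrArg₂ (fun (f : ℕ → ℂ) a ↦ HasSum f a) (funext fun n ↦ ?_) ?_) hcot
  · have hp := hfactor (n + 1)
    have hm := hfactor (-(n + 1))
    have hpne := hne (n + 1)
    have hmne := hne (-(n + 1))
    rw [integral_thetaPair hL hmu0 hmu1 hx.le]
    push_cast at hp hm hpne hmne ⊢
    have hm' : (L : ℂ) * ((n + 1) * (n + 1 - mu)) + x =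
        L * ((mu / 2 - w + (-1 + -n)) * (mu / 2 + w + (-1 + -n))) := by
      linear_combination -hm
    rw [← hp, hm']
    have e1 := left_ne_zero_of_mul hpne
    have e2 := right_ne_zero_of_mul hpne
    have e3 : (mu / 2 - w - (n + 1) : ℂ) ≠ 0 := fun h ↦
      left_ne_zero_of_mul hmne (by linear_combination h)
    have e4 : (mu / 2 + w - (n + 1) : ℂ) ≠ 0 := fun h ↦
      right_ne_zero_of_mul hmne (by linear_combination h)
    rw [show (mu / 2 - w + (-1 + -n) : ℂ) = mu / 2 - w - (n + 1) by ring,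
      show (mu / 2 + w + (-1 + -n) : ℂ) = mu / 2 + w - (n + 1) by ring]
    generalize hP : (mu / 2 - w + (n + 1) : ℂ) = P at *
    generalize hQ : (mu / 2 + w + (n + 1) : ℂ) = Q at *
    generalize hR : (mu / 2 - w - (n + 1) : ℂ) = R at *
    generalize hS : (mu / 2 + w - (n + 1) : ℂ) = S at *
    rw [show (n + 1 + mu / 2 : ℂ) = (P + Q) / 2 by rw [← hP, ← hQ]; ring,
      show (n + 1 - mu / 2 : ℂ) = -(R + S) / 2 by rw [← hR, ← hS]; ring]
    field_simp
    ring
  · have h0 := hfactor 0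
    have h0ne := hne 0
    push_cast at h0 h0ne
    simp only [add_zero, zero_mul, mul_zero, zero_add] at h0 h0ne
    have e1 := left_ne_zero_of_mul h0ne
    have e2 := right_ne_zero_of_mul h0ne
    have hs1 := sin_pi_mul_ne_zero hz1
    have hs2 := sin_pi_mul_ne_zero hz2
    rw [mul_sub] at hs1
    rw [mul_add] at hs2
    have hadd := cot_sub_add_cot_add hs1 hs2
    rw [← mul_sub, ← mul_add] at hadd
    have hcos : (cosPiSqrt (mu ^ 2 - 4 * x / L) : ℂ) = Complex.cos (2 * (Real.pi * w)) := by
      rw [cosPiSqrt_eq_cos (w := 2 * w)]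
      · ring_nf
      · rw [mul_pow, hw]
        push_cast
        ring
    have hinv : (mu / 2 / x : ℂ) = 1 / (2 * L) * (1 / (mu / 2 - w) + 1 / (mu / 2 + w)) := by
      have hPQ {P Q : ℂ} (hP : P ≠ 0) (hQ : Q ≠ 0) :
          (P + Q) / 2 / (L * (P * Q)) = 1 / (2 * L) * (1 / P + 1 / Q) := by
        field_simp
        ring
      rw [← hPQ e1 e2, h0]
      ring
    push_cast
    rw [hcos, hinv]
    rw [show (2 : ℂ) * (Real.pi * (mu / 2)) = Real.pi * mu by ring] at hadd
    linear_combination -(Real.pi / (2 * L) : ℂ) * hadd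

/-- Laplace transform of `θ_{μ1}`: for `λ1, λ2 > 0`, `μ1 = λ1/(λ1+λ2)` and every `x ≥ 0`,
`∫_0^∞ θ_{μ1}(e^{−(λ1+λ2)u}) e^{−ux} du
  = (1/(λ1+λ2)) π sin(πμ1) / (cos(π√(μ1² − 4x/(λ1+λ2))) − cos(πμ1))`. -/
theorem laplace_transform_thetaMu (l1 l2 : ℝ) (hl1 : 0 < l1) (hl2 : 0 < l2)
    (mu1 : ℝ) (hmu1 : mu1 = l1 / (l1 + l2)) :
    ∀ x ≥ (0:ℝ),
      (∫ u in Set.Ioi (0:ℝ), thetaMu mu1 (Real.exp (-(l1 + l2) * u)) * Real.exp (-u * x))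
        = (1 / (l1 + l2)) * (Real.pi * Real.sin (Real.pi * mu1))
            / (cosPiSqrt (mu1 ^ 2 - 4 * x / (l1 + l2)) - Real.cos (Real.pi * mu1)) := by
  intro x hx
  have hL : 0 < l1 + l2 := add_pos hl1 hl2
  have h0 : 0 < mu1 := hmu1 ▸ div_pos hl1 hL
  have h1 : mu1 < 1 := by rw [hmu1, div_lt_one hL]; linarith
  obtain ⟨hint, hsum⟩ := integrable_and_hasSum_integral_of_hasSum
    (integrable_thetaPair hL h0 h1 hx) (summable_integral_norm_thetaPair hL h0 h1 hx)
    ((ae_restrict_iff' measurableSet_Ioi).2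
      (Eventually.of_forall fun u hu ↦ hasSum_thetaPair hL h0 h1 hu x))
  rcases hx.eq_or_lt with rfl | hx
  · have hcos : cosPiSqrt (mu1 ^ 2) = Real.cos (Real.pi * mu1) := by
      have := cosPiSqrt_eq_cos (z := mu1 ^ 2) (w := mu1) (by push_cast; rfl)
      exact_mod_cast this
    rw [mul_zero, zero_div, sub_zero, hcos, sub_self, div_zero]
    -- The integrand tends to `mu1 / 2` at infinity, so both sides take their junk value `0`.
    refine integral_undef fun hθ ↦ ?_
    have hconst := hθ.sub hint
    simp only [Pi.sub_def, sub_sub_cancel, neg_zero, zero_mul, Real.exp_zero, mul_one] at hconst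
    rw [integrable_const_iff] at hconst
    rcases hconst with h | h
    · linarith
    · simpa using h.measure_univ_lt_top
  · have hexp := (integrableOn_exp_mul_Ioi (neg_lt_zero.2 hx) 0).const_mul (mu1 / 2)
    have key := hsum.unique (hasSum_integral_thetaPair hL h0 h1 hx)
    have hadd := integral_add hint hexp
    simp only [sub_add_cancel] at hadd
    rw [hadd, key, integral_const_mul, integral_exp_neg_mul_Ioi_zero hx]
    ring
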